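/- Let A be an artin algebra. Two indecomposable endofinite A-modules M and N are isomorphic if and only if sub M = sub N. -/

import Mathlib

universe w v

/-- An affine subspace of `P` is finitary with respect to a family of linear maps `π i` if
membership only depends on the values of finitely many `π i`. -/
def AffineSubspace.IsFinitary {R P N ι : Type*} [Ring R] [AddCommGroup P] [Module R P]
    [AddCommGroup N] [Module R N] (π : ι → P →ₗ[R] N) (B : AffineSubspace R P) : Prop :=
  ∃ F : Finset ι, ∀ p q : P, (∀ i ∈ F, π i p = π i q) → p ∈ B → q ∈ B

/-- Every finitely realizable family of prescribed values of the maps `π i` is realizable. -/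
def IsFinitelyComplete {R P N ι : Type*} [Ring R] [AddCommGroup P] [Module R P]
    [AddCommGroup N] [Module R N] (π : ι → P →ₗ[R] N) : Prop :=
  ∀ c : ι → N, (∀ F : Finset ι, ∃ p, ∀ i ∈ F, π i p = c i) → ∃ p, ∀ i, π i p = c i

section LinearCompactness

variable {R P N ι : Type*} [Ring R] [AddCommGroup P] [Module R P]
  [AddCommGroup N] [Module R N] {π : ι → P →ₗ[R] N}

theorem AffineSubspace.IsFinitary.inf {B C : AffineSubspace R P}
    (hB : B.IsFinitary π) (hC : C.IsFinitary π) : (B ⊓ C).IsFinitary π := by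
  classical
  obtain ⟨F, hF⟩ := hB
  obtain ⟨G, hG⟩ := hC
  refine ⟨F ∪ G, fun p q h hp => ?_⟩
  rw [AffineSubspace.mem_inf_iff] at hp ⊢
  exact ⟨hF p q (fun i hi => h i (Finset.mem_union_left _ hi)) hp.1,
    hG p q (fun i hi => h i (Finset.mem_union_right _ hi)) hp.2⟩

theorem AffineSubspace.isFinitary_top : (⊤ : AffineSubspace R P).IsFinitary π :=
  ⟨∅, fun _ _ _ _ => AffineSubspace.mem_top _ _ _⟩

theorem AffineSubspace.isFinitary_comap (i : ι) (C : AffineSubspace R N) :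
    (C.comap (π i).toAffineMap).IsFinitary π := by
  refine ⟨{i}, fun p q h hp => ?_⟩
  have := h i (Finset.mem_singleton_self i)
  simpa [AffineSubspace.mem_comap, this] using hp

/-- A filter base of nonempty finitary affine subspaces. -/
def IsFinitaryBase (π : ι → P →ₗ[R] N) (S : Set (AffineSubspace R P)) : Prop :=
  (∀ B ∈ S, B.IsFinitary π) ∧ (∀ B ∈ S, ∀ C ∈ S, B ⊓ C ∈ S) ∧
    ∀ B ∈ S, (B : Set P).Nonempty

theorem exists_maximal_isFinitaryBase {S : Set (AffineSubspace R P)}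
    (hS : IsFinitaryBase π S) : ∃ T, S ⊆ T ∧ Maximal (IsFinitaryBase π) T := by
  obtain ⟨T, hST, hT⟩ := zorn_subset_nonempty {T | IsFinitaryBase π T} (by
    intro c hc hch hne
    refine ⟨⋃₀ c, ⟨?_, ?_, ?_⟩, fun s hs => Set.subset_sUnion_of_mem hs⟩
    · rintro B ⟨s, hs, hB⟩
      exact (hc hs).1 B hB
    · rintro B ⟨s, hs, hB⟩ C ⟨t, ht, hC⟩
      rcases hch.total hs ht with h | h
      · exact ⟨t, ht, (hc ht).2.1 B (h hB) C hC⟩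
      · exact ⟨s, hs, (hc hs).2.1 B hB C (h hC)⟩
    · rintro B ⟨s, hs, hB⟩
      exact (hc hs).2.2 B hB) S hS
  exact ⟨T, hST, hT⟩

theorem mem_of_maximal_isFinitaryBase {T : Set (AffineSubspace R P)}
    (hT : Maximal (IsFinitaryBase π) T) (hne : T.Nonempty) {B₀ : AffineSubspace R P}
    (hB₀ : B₀.IsFinitary π) (h : ∀ B ∈ T, ((B ⊓ B₀ : AffineSubspace R P) : Set P).Nonempty) :
    B₀ ∈ T := by
  have hU : IsFinitaryBase π {C | C.IsFinitary π ∧ ∃ B ∈ T, B ⊓ B₀ ≤ C} := by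
    refine ⟨fun C hC => hC.1, ?_, ?_⟩
    · rintro C ⟨hC, B, hB, hBC⟩ C' ⟨hC', B', hB', hBC'⟩
      refine ⟨hC.inf hC', B ⊓ B', hT.prop.2.1 B hB B' hB', le_inf ?_ ?_⟩
      · exact le_trans (inf_le_inf_right _ inf_le_left) hBC
      · exact le_trans (inf_le_inf_right _ inf_le_right) hBC'
    · rintro C ⟨-, B, hB, hBC⟩
      exact (h B hB).mono hBC
  obtain ⟨B, hB⟩ := hne
  exact hT.le_of_ge hU (fun C hC => ⟨hT.prop.1 C hC, C, hC, inf_le_left⟩)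
    ⟨hB₀, B, hB, inf_le_right⟩

/-- Linear compactness: every proper filter on `P` has a point lying in all finitary affine
subspaces that belong to the filter. -/
theorem exists_mem_of_filter [IsArtinian R N] (hπ : IsFinitelyComplete π)
    (l : Filter P) [l.NeBot] :
    ∃ p : P, ∀ B : AffineSubspace R P, B.IsFinitary π → (B : Set P) ∈ l → p ∈ B := by
  have hS : IsFinitaryBase π {B : AffineSubspace R P | B.IsFinitary π ∧ (B : Set P) ∈ l} :=
    ⟨fun B hB => hB.1,
      fun B hB C hC => ⟨hB.1.inf hC.1, Filter.inter_mem hB.2 hC.2⟩,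
      fun B hB => Filter.nonempty_of_mem hB.2⟩
  obtain ⟨T, hST, hT⟩ := exists_maximal_isFinitaryBase hS
  have htop : (⊤ : AffineSubspace R P) ∈ T :=
    hST ⟨AffineSubspace.isFinitary_top, by simp⟩
  have key : ∀ i, ∃ c : N,
      (AffineSubspace.mk' c (⊥ : Submodule R N)).comap (π i).toAffineMap ∈ T := by
    intro i
    let 𝒞 : Set (Submodule R N) :=
      {W | ∃ C : AffineSubspace R N, C.comap (π i).toAffineMap ∈ T ∧ C.direction = W}
    obtain ⟨W, ⟨C, hCT, hCW⟩, hmin⟩ := (IsWellFounded.wf (r := ((· < ·) :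
      Submodule R N → Submodule R N → Prop))).has_min 𝒞 ⟨_, ⊤, by simpa using htop, rfl⟩
    obtain ⟨p, hp⟩ := hT.prop.2.2 _ hCT
    refine ⟨π i p, mem_of_maximal_isFinitaryBase hT ⟨_, htop⟩
      (AffineSubspace.isFinitary_comap i _) fun B hB => ?_⟩
    have hB' : (B.map (π i).toAffineMap).comap (π i).toAffineMap ∈ T := by
      refine mem_of_maximal_isFinitaryBase hT ⟨_, htop⟩
        (AffineSubspace.isFinitary_comap i _) fun D hD => ?_
      exact (hT.prop.2.2 _ (hT.prop.2.1 D hD B hB)).mono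
        (inf_le_inf_left D (AffineSubspace.le_comap_map _ _))
    have hinf : (C ⊓ B.map (π i).toAffineMap).comap (π i).toAffineMap ∈ T := by
      rw [AffineSubspace.comap_inf]
      exact hT.prop.2.1 _ hCT _ hB'
    have hdir : (C ⊓ B.map (π i).toAffineMap).direction = C.direction := by
      by_contra hne
      exact hmin _ ⟨_, hinf, rfl⟩
        (hCW ▸ lt_of_le_of_ne (AffineSubspace.direction_le inf_le_left) hne)
    have heq : C ⊓ B.map (π i).toAffineMap = C := by
      refine AffineSubspace.eq_of_direction_eq_of_nonempty_of_le hdir ?_ inf_le_left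
      obtain ⟨q, hq⟩ := hT.prop.2.2 _ hinf
      exact ⟨_, hq⟩
    have hpB : π i p ∈ B.map (π i).toAffineMap := by
      have : π i p ∈ C ⊓ B.map (π i).toAffineMap := by
        rw [heq]
        exact hp
      exact this.2
    obtain ⟨q, hq, hqp⟩ := hpB
    refine ⟨q, hq, ?_⟩
    have hqp' : π i q = π i p := hqp
    simp [hqp']
  choose c hc using key
  have hfin : ∀ F : Finset ι, ∀ B ∈ T, ∃ p ∈ B, ∀ i ∈ F, π i p = c i := by
    classical
    intro F B hB
    suffices h : ∃ D ∈ T, D ≤ B ∧ ∀ p ∈ D, ∀ i ∈ F, π i p = c i by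
      obtain ⟨D, hD, hDB, hDF⟩ := h
      obtain ⟨p, hp⟩ := hT.prop.2.2 D hD
      exact ⟨p, hDB hp, hDF p hp⟩
    induction F using Finset.induction_on with
    | empty => exact ⟨B, hB, le_rfl, by simp⟩
    | insert i F _ ih =>
      obtain ⟨D, hD, hDB, hDF⟩ := ih
      refine ⟨_, hT.prop.2.1 D hD _ (hc i), inf_le_left.trans hDB, fun p hp j hj => ?_⟩
      rcases Finset.mem_insert.mp hj with rfl | hj
      · have := hp.2
        simpa [AffineSubspace.mem_comap, AffineSubspace.mem_mk', sub_eq_zero] using this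
      · exact hDF p hp.1 j hj
  obtain ⟨p, hp⟩ := hπ c fun F => by
    obtain ⟨p, -, hp⟩ := hfin F ⊤ htop
    exact ⟨p, hp⟩
  refine ⟨p, fun B hB hBl => ?_⟩
  obtain ⟨F, hF⟩ := hB
  obtain ⟨q, hqB, hq⟩ := hfin F B (hST ⟨⟨F, hF⟩, hBl⟩)
  exact hF q p (fun i hi => (hq i hi).trans (hp i).symm) hqB

end LinearCompactness

section Idempotents

variable {R M : Type*} [Ring R] [AddCommGroup M] [Module R M]

/-- A set of ring elements is finitarily closed if it is an intersection of affine subspaces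
defined by finitely many values on `M`. -/
def IsFinitarilyClosed (M : Type*) [AddCommGroup M] [Module R M] (T : Set R) : Prop :=
  ∀ p : R, (∀ B : AffineSubspace R R, B.IsFinitary (LinearMap.toSpanSingleton R M) →
    T ⊆ B → p ∈ B) → p ∈ T

theorem IsFinitarilyClosed.inter {T U : Set R} (hT : IsFinitarilyClosed M T)
    (hU : IsFinitarilyClosed M U) : IsFinitarilyClosed M (T ∩ U) := fun p hp =>
  ⟨hT p fun B hB h => hp B hB (Set.inter_subset_left.trans h),
    hU p fun B hB h => hp B hB (Set.inter_subset_right.trans h)⟩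

theorem isFinitarilyClosed_smul_eq (x y : M) : IsFinitarilyClosed M {r : R | r • x = y} := by
  intro p hp
  have := hp _ (AffineSubspace.isFinitary_comap (π := LinearMap.toSpanSingleton R M) x
    (AffineSubspace.mk' y ⊥)) (by
      intro r hr
      have hr' : r • x = y := hr
      simp [AffineSubspace.mem_mk', hr'])
  simpa [AffineSubspace.mem_comap, AffineSubspace.mem_mk', sub_eq_zero] using this

theorem isFinitarilyClosed_sInter {c : Set (Set R)} (hc : ∀ T ∈ c, IsFinitarilyClosed M T) :
    IsFinitarilyClosed M (⋂₀ c) := fun p hp T hT =>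
  hc T hT p fun B hB h => hp B hB ((Set.sInter_subset_of_mem hT).trans h)

theorem isFinitarilyClosed_univ : IsFinitarilyClosed M (Set.univ : Set R) := fun _ _ => trivial

theorem isFinitarilyClosed_mul_eq [FaithfulSMul R M] (s u : R) :
    IsFinitarilyClosed M {r : R | r * s = u} := by
  have : {r : R | r * s = u} = ⋂₀ Set.range fun m : M => {r : R | r • (s • m) = u • m} := by
    ext r
    simp only [Set.mem_ofPred_eq, Set.sInter_range, Set.mem_iInter, ← mul_smul]
    exact ⟨fun h m => by rw [h], fun h => FaithfulSMul.eq_of_smul_eq_smul h⟩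
  rw [this]
  refine isFinitarilyClosed_sInter ?_
  rintro _ ⟨m, rfl⟩
  exact isFinitarilyClosed_smul_eq _ _

theorem IsFinitarilyClosed.nonempty_sInter [IsArtinian R M]
    (hπ : IsFinitelyComplete (LinearMap.toSpanSingleton R M)) {c : Set (Set R)}
    (hc : ∀ T ∈ c, IsFinitarilyClosed M T) (hne : ∀ T ∈ c, T.Nonempty)
    (hchain : IsChain (· ⊆ ·) c) : (⋂₀ c).Nonempty := by
  have hb : (Filter.generate c).NeBot := by
    rw [Filter.generate_neBot_iff]
    intro t ht hfin
    rcases t.eq_empty_or_nonempty with rfl | htne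
    · simp
    obtain ⟨T, hT⟩ := hfin.exists_minimal htne
    refine (hne T (ht hT.prop)).mono fun x hx U hU => ?_
    rcases hchain.total (ht hT.prop) (ht hU) with h | h
    · exact h hx
    · exact hT.le_of_le hU h hx
  obtain ⟨p, hp⟩ := exists_mem_of_filter hπ (Filter.generate c)
  exact ⟨p, fun T hT => hc T hT p fun B hB hTB =>
    hp B hB (Filter.mem_of_superset (Filter.mem_generate_of_mem hT) hTB)⟩

theorem exists_mem_smul_smul_eq {B : AffineSubspace R R} {T : Set R} (hTB : T ⊆ B)
    {s p : R} (hp : ∀ B : AffineSubspace R R, B.IsFinitary (LinearMap.toSpanSingleton R M) →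
      Set.image (· * s) T ⊆ B → p ∈ B) (F : Finset M) :
    ∃ r ∈ B, ∀ m ∈ F, r • (s • m) = p • m := by
  let φ : R →ₗ[R] (F → M) := LinearMap.pi fun m => LinearMap.toSpanSingleton R M (m : M)
  let g : R →ₗ[R] R := LinearMap.toSpanSingleton R R s
  have := hp ((B.map (φ ∘ₗ g).toAffineMap).comap φ.toAffineMap) ?_ ?_
  · obtain ⟨r, hr, hrp⟩ := this
    refine ⟨r, hr, fun m hm => ?_⟩
    have := congrFun hrp ⟨m, hm⟩
    simpa [φ, g, mul_smul] using this
  · refine ⟨F, fun q q' h hq => ?_⟩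
    have : φ q = φ q' := funext fun m => h m m.2
    simpa [AffineSubspace.mem_comap, this] using hq
  · rintro _ ⟨t, ht, rfl⟩
    exact ⟨t, hTB ht, rfl⟩

theorem IsFinitarilyClosed.image_mul_right [IsArtinian R M] [FaithfulSMul R M]
    (hπ : IsFinitelyComplete (LinearMap.toSpanSingleton R M)) {T : Set R}
    (hT : IsFinitarilyClosed M T) (s : R) : IsFinitarilyClosed M (Set.image (· * s) T) := by
  classical
  intro p hp
  let l : Filter R :=
    { sets := {U | ∃ B : AffineSubspace R R,
        B.IsFinitary (LinearMap.toSpanSingleton R M) ∧ T ⊆ B ∧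
          ∃ F : Finset M, ∀ r ∈ B, (∀ m ∈ F, r • (s • m) = p • m) → r ∈ U}
      univ_sets := ⟨⊤, AffineSubspace.isFinitary_top, by simp, ∅, by simp⟩
      sets_of_superset := by
        rintro U V ⟨B, hB, hTB, F, hF⟩ hUV
        exact ⟨B, hB, hTB, F, fun r hr h => hUV (hF r hr h)⟩
      inter_sets := by
        rintro U V ⟨B, hB, hTB, F, hF⟩ ⟨C, hC, hTC, G, hG⟩
        refine ⟨B ⊓ C, hB.inf hC, fun t ht => ⟨hTB ht, hTC ht⟩, F ∪ G, fun r hr h => ?_⟩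
        exact ⟨hF r hr.1 fun m hm => h m (Finset.mem_union_left _ hm),
          hG r hr.2 fun m hm => h m (Finset.mem_union_right _ hm)⟩ }
  have hl : l.NeBot := by
    rw [← Filter.empty_mem_iff_bot.not.trans Filter.neBot_iff.symm]
    rintro ⟨B, -, hTB, F, hF⟩
    obtain ⟨r, hr, h⟩ := exists_mem_smul_smul_eq hTB hp F
    exact hF r hr h
  obtain ⟨r, hr⟩ := exists_mem_of_filter hπ l
  refine ⟨r, hT r fun B hB hTB => hr B hB ⟨B, hB, hTB, ∅, fun q hq _ => hq⟩, ?_⟩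
  refine FaithfulSMul.eq_of_smul_eq_smul fun m : M => ?_
  have := hr _ (AffineSubspace.isFinitary_comap (π := LinearMap.toSpanSingleton R M) (s • m)
    (AffineSubspace.mk' (p • m) ⊥)) ⟨⊤, AffineSubspace.isFinitary_top, by simp, {m}, by
      intro q _ hq
      have := hq m (Finset.mem_singleton_self m)
      simp [AffineSubspace.mem_mk', this]⟩
  simpa [AffineSubspace.mem_comap, AffineSubspace.mem_mk', sub_eq_zero, mul_smul] using this

/-- A finitarily closed nonempty multiplicatively closed set contains an idempotent
(a linearly compact analogue of the Ellis-Numakura lemma). -/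
theorem IsFinitarilyClosed.exists_isIdempotentElem [IsArtinian R M] [FaithfulSMul R M]
    (hπ : IsFinitelyComplete (LinearMap.toSpanSingleton R M)) {S : Set R}
    (hS : IsFinitarilyClosed M S) (hne : S.Nonempty) (hmul : ∀ a ∈ S, ∀ b ∈ S, a * b ∈ S) :
    ∃ e ∈ S, IsIdempotentElem e := by
  let 𝒯 : Set (Set R) :=
    {T | IsFinitarilyClosed M T ∧ T.Nonempty ∧ ∀ a ∈ T, ∀ b ∈ T, a * b ∈ T}
  obtain ⟨T, hTS, hT⟩ := zorn_superset_nonempty 𝒯 (by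
    intro c hc hch _
    refine ⟨⋂₀ c, ⟨isFinitarilyClosed_sInter fun T hT => (hc hT).1,
      IsFinitarilyClosed.nonempty_sInter hπ (fun T hT => (hc hT).1)
        (fun T hT => (hc hT).2.1) hch,
      fun a ha b hb T hT => (hc hT).2.2 a (ha T hT) b (hb T hT)⟩,
      fun s hs => Set.sInter_subset_of_mem hs⟩) S ⟨hS, hne, hmul⟩
  obtain ⟨hTc, ⟨s, hs⟩, hTm⟩ := hT.prop
  refine ⟨s, hTS hs, ?_⟩
  have h₁ : Set.image (· * s) T ∈ 𝒯 := by
    refine ⟨hTc.image_mul_right hπ s, ⟨_, s, hs, rfl⟩, ?_⟩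
    rintro _ ⟨a, ha, rfl⟩ _ ⟨b, hb, rfl⟩
    exact ⟨a * s * b, hTm _ (hTm a ha s hs) b hb, by simp [mul_assoc]⟩
  have h₁' : Set.image (· * s) T ⊆ T := by
    rintro _ ⟨a, ha, rfl⟩
    exact hTm a ha s hs
  obtain ⟨t, ht, hts⟩ := hT.le_of_le h₁ h₁' hs
  have h₂ : T ∩ {r | r * s = s} ∈ 𝒯 := by
    refine ⟨hTc.inter (isFinitarilyClosed_mul_eq s s), ⟨t, ht, hts⟩, ?_⟩
    rintro a ⟨ha, has⟩ b ⟨hb, hbs⟩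
    have has' : a * s = s := has
    have hbs' : b * s = s := hbs
    exact ⟨hTm a ha b hb, show a * b * s = s by rw [mul_assoc, hbs', has']⟩
  exact (hT.le_of_le h₂ Set.inter_subset_left hs).2

theorem exists_isIdempotentElem_mul_smul_eq [IsArtinian R M] [FaithfulSMul R M]
    (hπ : IsFinitelyComplete (LinearMap.toSpanSingleton R M)) {a : R} {x : M}
    (hax : a • x = x) : ∃ r : R, IsIdempotentElem (r * a) ∧ (r * a) • x = x := by
  obtain ⟨_, ⟨⟨r, -, rfl⟩, hx⟩, he⟩ := IsFinitarilyClosed.exists_isIdempotentElem hπ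
    ((isFinitarilyClosed_univ.image_mul_right hπ a).inter (isFinitarilyClosed_smul_eq x x))
    ⟨a, ⟨1, trivial, one_mul a⟩, hax⟩ (by
      rintro _ ⟨⟨r, -, rfl⟩, hr⟩ _ ⟨⟨t, -, rfl⟩, ht⟩
      have hr' : (r * a) • x = x := hr
      have ht' : (t * a) • x = x := ht
      refine ⟨⟨r * a * t, trivial, by simp [mul_assoc]⟩, ?_⟩
      change ((r * a) * (t * a)) • x = x
      rw [mul_smul, ht', hr'])
  exact ⟨r, he, hx⟩

end Idempotents

section Endofinite

variable {A M N : Type*} [Ring A] [AddCommGroup M] [Module A M] [AddCommGroup N] [Module A N]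

theorem isFinitelyComplete_end :
    IsFinitelyComplete (LinearMap.toSpanSingleton (Module.End A M) M) := by
  classical
  intro c hc
  refine ⟨{ toFun := c, map_add' := fun x y => ?_, map_smul' := fun a x => ?_ }, fun m => rfl⟩
  · obtain ⟨p, hp⟩ := hc {x, y, x + y}
    simp only [LinearMap.toSpanSingleton_apply, Module.End.smul_def] at hp
    rw [← hp x (by simp), ← hp y (by simp), ← hp (x + y) (by simp), map_add]
  · obtain ⟨p, hp⟩ := hc {x, a • x}
    simp only [LinearMap.toSpanSingleton_apply, Module.End.smul_def] at hp
    rw [← hp x (by simp), ← hp (a • x) (by simp), map_smul, RingHom.id_apply]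

theorem eq_one_of_isIdempotentElem
    (hM : ∀ U V : Submodule A M, IsCompl U V → U = ⊥ ∨ V = ⊥) {e : Module.End A M}
    (he : IsIdempotentElem e) (hne : e ≠ 0) : e = 1 := by
  rcases hM _ _ (LinearMap.IsIdempotentElem.isCompl he) with h | h
  · exact absurd (LinearMap.range_eq_bot.mp h) hne
  · refine LinearMap.ext fun m => LinearMap.ker_eq_bot.mp h ?_
    exact LinearMap.congr_fun he m

/-- If a composition `M → N → M` fixes a nonzero vector, then `M` and `N` are isomorphic. -/
theorem nonempty_linearEquiv_of_comp_apply_eq [IsArtinian (Module.End A M) M]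
    (hM : ∀ U V : Submodule A M, IsCompl U V → U = ⊥ ∨ V = ⊥)
    (hN : ∀ U V : Submodule A N, IsCompl U V → U = ⊥ ∨ V = ⊥)
    (f : M →ₗ[A] N) (h : N →ₗ[A] M) {x : M} (hx : x ≠ 0) (hfx : h (f x) = x) :
    Nonempty (M ≃ₗ[A] N) := by
  obtain ⟨r, he, hrx⟩ := exists_isIdempotentElem_mul_smul_eq (isFinitelyComplete_end (A := A))
    (a := (h ∘ₗ f : Module.End A M)) (x := x) hfx
  have h1 : r * (h ∘ₗ f : Module.End A M) = 1 :=
    eq_one_of_isIdempotentElem hM he fun h0 => hx (by rw [← hrx, h0, zero_smul])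
  let l : N →ₗ[A] M := r ∘ₗ h
  have hl : ∀ m, l (f m) = m := fun m => LinearMap.congr_fun h1 m
  have hfl : (f ∘ₗ l : Module.End A N) = 1 := by
    refine eq_one_of_isIdempotentElem hN ?_ fun h0 => hx ?_
    · ext n
      simp [hl]
    · have := LinearMap.congr_fun h0 (f x)
      simp only [LinearMap.comp_apply, hl, LinearMap.zero_apply] at this
      rw [← hl x, this, map_zero]
  exact ⟨LinearEquiv.ofLinearMap f l hfl (LinearMap.ext hl)⟩

/-- If homomorphisms from finitely generated submodules of `M` to `N` separate points, then so do
homomorphisms defined on all of `M`. -/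
theorem exists_linearMap_apply_ne_zero [IsArtinian (Module.End A N) N]
    (hsep : ∀ L : Submodule A M, L.FG → ∀ x : L, x ≠ 0 → ∃ f : L →ₗ[A] N, f x ≠ 0)
    {x : M} (hx : x ≠ 0) : ∃ f : M →ₗ[A] N, f x ≠ 0 := by
  classical
  let E := Module.End A N
  let I : {L : Submodule A M // L.FG ∧ x ∈ L} → Submodule E N := fun L =>
    { carrier := {y | ∃ f : L.1 →ₗ[A] N, f ⟨x, L.2.2⟩ = y}
      zero_mem' := ⟨0, rfl⟩
      add_mem' := by
        rintro _ _ ⟨f, rfl⟩ ⟨g, rfl⟩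
        exact ⟨f + g, rfl⟩
      smul_mem' := by
        rintro e _ ⟨f, rfl⟩
        exact ⟨e ∘ₗ f, rfl⟩ }
  have hanti : ∀ L L' : {L : Submodule A M // L.FG ∧ x ∈ L}, L.1 ≤ L'.1 → I L' ≤ I L := by
    rintro L L' hLL' _ ⟨f, rfl⟩
    exact ⟨f ∘ₗ Submodule.inclusion hLL', rfl⟩
  obtain ⟨_, ⟨L₁, rfl⟩, hmin⟩ := (IsWellFounded.wf (r := ((· < ·) :
    Submodule E N → Submodule E N → Prop))).has_min (Set.range I)
      ⟨_, ⟨A ∙ x, Submodule.fg_span_singleton x, Submodule.mem_span_singleton_self x⟩, rfl⟩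
  obtain ⟨f₁, hf₁⟩ := hsep L₁.1 L₁.2.1 ⟨x, L₁.2.2⟩ (by simpa using hx)
  set y := f₁ ⟨x, L₁.2.2⟩
  have hyI : ∀ L, y ∈ I L := by
    intro L
    let L' : {L : Submodule A M // L.FG ∧ x ∈ L} :=
      ⟨L₁.1 ⊔ L.1, L₁.2.1.sup L.2.1, Submodule.mem_sup_left L₁.2.2⟩
    have hle : I L' ≤ I L₁ := hanti _ _ le_sup_left
    have heq : I L' = I L₁ := by
      by_contra hne
      exact hmin _ ⟨L', rfl⟩ (lt_of_le_of_ne hle hne)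
    refine hanti L L' le_sup_right ?_
    rw [heq]
    exact ⟨f₁, rfl⟩
  let π : M → (M → N) →ₗ[E] N := fun m => LinearMap.proj m
  have hπ : IsFinitelyComplete π := fun c _ => ⟨c, fun _ => rfl⟩
  let l : Filter (M → N) :=
    { sets := {U | ∃ L : Submodule A M, L.FG ∧ x ∈ L ∧ ∀ c : M → N,
        (∃ f : L →ₗ[A] N, f.toFun = fun z : L => c z) → c x = y → c ∈ U}
      univ_sets := ⟨A ∙ x, Submodule.fg_span_singleton x, Submodule.mem_span_singleton_self x,
        fun _ _ _ => trivial⟩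
      sets_of_superset := by
        rintro U V ⟨L, hL, hxL, h⟩ hUV
        exact ⟨L, hL, hxL, fun c hc hcx => hUV (h c hc hcx)⟩
      inter_sets := by
        rintro U V ⟨L, hL, hxL, h⟩ ⟨L', hL', hxL', h'⟩
        refine ⟨L ⊔ L', hL.sup hL', Submodule.mem_sup_left hxL, fun c hc hcx => ?_⟩
        obtain ⟨f, hf⟩ := hc
        refine ⟨h c ⟨f ∘ₗ Submodule.inclusion le_sup_left, ?_⟩ hcx,
          h' c ⟨f ∘ₗ Submodule.inclusion le_sup_right, ?_⟩ hcx⟩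
        · ext z
          exact congrFun hf (Submodule.inclusion le_sup_left z)
        · ext z
          exact congrFun hf (Submodule.inclusion le_sup_right z) }
  have hl : l.NeBot := by
    rw [← Filter.empty_mem_iff_bot.not.trans Filter.neBot_iff.symm]
    rintro ⟨L, hL, hxL, h⟩
    obtain ⟨f, hf⟩ := hyI ⟨L, hL, hxL⟩
    refine h (fun m => if hm : m ∈ L then f ⟨m, hm⟩ else 0) ⟨f, ?_⟩ ?_
    · ext z
      simp
    · simpa [hxL] using hf
  obtain ⟨c, hc⟩ := exists_mem_of_filter hπ l
  have key : ∀ (φ : (M → N) →ₗ[E] N) (F : Finset M) (v : N),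
      (∀ p q : M → N, (∀ m ∈ F, p m = q m) → φ p = φ q) →
      (∀ (L : Submodule A M) (d : M → N), (∀ m ∈ F, m ∈ L) →
        (∃ f : L →ₗ[A] N, f.toFun = fun z : L => d z) → d x = y → φ d = v) → φ c = v := by
    intro φ F v hφ hv
    have := hc ((AffineSubspace.mk' v (⊥ : Submodule E N)).comap φ.toAffineMap)
      ⟨F, fun p q h hp => by simpa [AffineSubspace.mem_comap, hφ p q h] using hp⟩
      ⟨Submodule.span A (insert x F : Finset M), ⟨_, rfl⟩,
        Submodule.subset_span (by simp), fun d hd hdx => by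
          have := hv _ d (fun m hm => Submodule.subset_span (by simp [hm])) hd hdx
          simp [AffineSubspace.mem_mk', this]⟩
    simpa [AffineSubspace.mem_comap, AffineSubspace.mem_mk', sub_eq_zero] using this
  have hadd : ∀ m m', c (m + m') = c m + c m' := by
    intro m m'
    have := key (π (m + m') - (π m + π m'))
      {m, m', m + m'} 0 (fun p q h => by simp [π, h m, h m', h (m + m')]) (by
        rintro L d hL ⟨f, hf⟩ -
        have h₁ := congrFun hf ⟨m, hL m (by simp)⟩
        have h₂ := congrFun hf ⟨m', hL m' (by simp)⟩
        have h₃ : f (⟨m, hL m (by simp)⟩ + ⟨m', hL m' (by simp)⟩) = d (m + m') :=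
          congrFun hf ⟨m + m', hL (m + m') (by simp)⟩
        have h₁' : f ⟨m, hL m (by simp)⟩ = d m := h₁
        have h₂' : f ⟨m', hL m' (by simp)⟩ = d m' := h₂
        rw [map_add, h₁', h₂'] at h₃
        simp [π, ← h₃])
    simpa [π, sub_eq_zero] using this
  have hsmul : ∀ (a : A) (m : M), c (a • m) = a • c m := by
    intro a m
    let α : N →ₗ[E] N :=
      { toFun := fun n => a • n
        map_add' := smul_add a
        map_smul' := fun e n => (e.map_smul a n).symm }
    have := key (π (a • m) - α ∘ₗ π m)
      {m, a • m} 0 (fun p q h => by simp [π, h m, h (a • m)]) (by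
        rintro L d hL ⟨f, hf⟩ -
        have h₁ : f ⟨m, hL m (by simp)⟩ = d m := congrFun hf ⟨m, hL m (by simp)⟩
        have h₂ : f (a • ⟨m, hL m (by simp)⟩) = d (a • m) :=
          congrFun hf ⟨a • m, hL (a • m) (by simp)⟩
        rw [map_smul, h₁] at h₂
        simp [π, α, ← h₂])
    simpa [π, α, sub_eq_zero] using this
  have hcx : c x = y := key (π x) {x} y (fun p q h => h x (by simp))
    fun L d _ _ hdx => hdx
  exact ⟨{ toFun := c, map_add' := hadd, map_smul' := hsmul }, fun h => hf₁ (hcx.symm.trans h)⟩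

/-- Homomorphisms between `M` and `N` that separate points in both directions force an
isomorphism between indecomposable modules. -/
theorem nonempty_linearEquiv_of_separating [IsArtinian (Module.End A M) M]  [Nontrivial M]
    (hM : ∀ U V : Submodule A M, IsCompl U V → U = ⊥ ∨ V = ⊥)
    (hN : ∀ U V : Submodule A N, IsCompl U V → U = ⊥ ∨ V = ⊥)
    (hMN : ∀ x : M, x ≠ 0 → ∃ f : M →ₗ[A] N, f x ≠ 0)
    (hNM : ∀ x : N, x ≠ 0 → ∃ f : N →ₗ[A] M, f x ≠ 0) :
    Nonempty (M ≃ₗ[A] N) := by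
  obtain ⟨S, hS, -⟩ := (eq_bot_or_exists_atom_le (⊤ : Submodule (Module.End A M) M)).resolve_left
    top_ne_bot
  obtain ⟨x, hxS, hx⟩ := S.exists_mem_ne_zero_of_ne_bot hS.1
  obtain ⟨f, hf⟩ := hMN x hx
  obtain ⟨g, hg⟩ := hNM _ hf
  have hgS : g (f x) ∈ S := S.smul_mem (g ∘ₗ f : Module.End A M) hxS
  have hspan : Submodule.span (Module.End A M) {g (f x)} = S :=
    (hS.le_iff.mp ((Submodule.span_singleton_le_iff_mem _ _).mpr hgS)).resolve_left
      (by simpa using hg)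
  rw [← hspan] at hxS
  obtain ⟨r, hr⟩ := Submodule.mem_span_singleton.mp hxS
  exact nonempty_linearEquiv_of_comp_apply_eq hM hN f (r ∘ₗ g) hx hr

theorem exists_injective_fin_pi (L : Submodule A M) :
    ∃ (n : ℕ) (f : L →ₗ[A] (Fin n → M)), Function.Injective f :=
  ⟨1, LinearMap.pi fun _ => L.subtype, fun _ _ h => Subtype.ext (congrFun h 0)⟩

theorem exists_linearMap_apply_ne_zero_of_injective_pi {ι : Type*} (f : M →ₗ[A] (ι → N))
    (hf : Function.Injective f) {x : M} (hx : x ≠ 0) : ∃ g : M →ₗ[A] N, g x ≠ 0 := by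
  by_contra! hall
  exact hx (hf (by
    rw [map_zero]
    exact funext fun i => hall (LinearMap.proj i ∘ₗ f)))

end Endofinite

/-- Two indecomposable endofinite modules `M`, `N` over an artin algebra `A` are
isomorphic if and only if `sub M = sub N`, where `sub M` consists of all finite-length
submodules of finite direct sums of copies of `M`. -/
theorem statement15 (k : Type w) [CommRing k] [IsArtinianRing k]
    (A : Type v) [Ring A] [Algebra k A] [Module.Finite k A]
    (M N : Type v) [AddCommGroup M] [Module A M] [AddCommGroup N] [Module A N]
    (hMind : Nontrivial M ∧ ∀ U V : Submodule A M, IsCompl U V → U = ⊥ ∨ V = ⊥)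
    (hNind : Nontrivial N ∧ ∀ U V : Submodule A N, IsCompl U V → U = ⊥ ∨ V = ⊥)
    (hMend : IsFiniteLength (Module.End A M) M)
    (hNend : IsFiniteLength (Module.End A N) N) :
    Nonempty (M ≃ₗ[A] N) ↔
      ∀ (L : Type v) [AddCommGroup L] [Module A L],
        ((IsFiniteLength A L ∧ ∃ (n : ℕ) (f : L →ₗ[A] (Fin n → M)), Function.Injective f) ↔
         (IsFiniteLength A L ∧ ∃ (n : ℕ) (f : L →ₗ[A] (Fin n → N)), Function.Injective f)) := by
  have hMf := isFiniteLength_iff_isNoetherian_isArtinian.mp hMend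
  have hNf := isFiniteLength_iff_isNoetherian_isArtinian.mp hNend
  have := hMf.2
  have := hNf.2
  have := hMind.1
  have : IsArtinianRing A := IsArtinianRing.of_finite k A
  have hfl : ∀ (X : Type v) [AddCommGroup X] [Module A X] (L : Submodule A X), L.FG →
      IsFiniteLength A L := fun X _ _ L hL => by
    have := Module.Finite.iff_fg.mpr hL
    exact isFiniteLength_iff_isNoetherian_isArtinian.mpr ⟨inferInstance, inferInstance⟩
  constructor
  · rintro ⟨e⟩ L _ _
    refine and_congr_right fun _ => ⟨?_, ?_⟩
    · rintro ⟨n, f, hf⟩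
      exact ⟨n, (LinearEquiv.piCongrRight fun _ => e).toLinearMap ∘ₗ f,
        (LinearEquiv.piCongrRight fun _ : Fin n => e).injective.comp hf⟩
    · rintro ⟨n, f, hf⟩
      exact ⟨n, (LinearEquiv.piCongrRight fun _ => e.symm).toLinearMap ∘ₗ f,
        (LinearEquiv.piCongrRight fun _ : Fin n => e.symm).injective.comp hf⟩
  · intro h
    refine nonempty_linearEquiv_of_separating hMind.2 hNind.2
      (fun x hx => exists_linearMap_apply_ne_zero (fun L hL z hz => ?_) hx)
      (fun x hx => exists_linearMap_apply_ne_zero (fun L hL z hz => ?_) hx)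
    · obtain ⟨-, n, f, hf⟩ := (h L).mp ⟨hfl M L hL, exists_injective_fin_pi L⟩
      exact exists_linearMap_apply_ne_zero_of_injective_pi f hf hz
    · obtain ⟨-, n, f, hf⟩ := (h L).mpr ⟨hfl N L hL, exists_injective_fin_pi L⟩
      exact exists_linearMap_apply_ne_zero_of_injective_pi f hf hz
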